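/- Let r ≥ 1 be a fixed integer and p_1, ..., p_r be fixed distinct primes. Then the number P^{(e)}(p_1,...,p_r;x) of ordered pairs ⟨n,m⟩ of exponentially coprime integers with κ(n) = κ(m) = p_1 ⋯ p_r and n, m ≤ x satisfies P^{(e)}(p_1,...,p_r;x) = (1/((r!)^2 (ζ(2))^r)) (∏_{i=1}^r 1/(log p_i)^2) (log x)^{2r} + O((log x)^{2r-1} log log x) as x → ∞. -/

import Mathlib

open Filter

/-- Two positive integers are *exponentially coprime* if they have the same prime
factors and the exponents of each common prime factor are coprime; `1` and `1` are
exponentially coprime, while `1` and `m > 1` are not. -/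
def ExpCoprime (n m : ℕ) : Prop :=
  (n = 1 ∧ m = 1) ∨
    (1 < n ∧ 1 < m ∧ n.primeFactors = m.primeFactors ∧
      ∀ p ∈ n.primeFactors, Nat.Coprime (n.factorization p) (m.factorization p))

section

open ArithmeticFunction Finset

lemma sum_divisors_moebius_eq_ite (n : ℕ) :
    ∑ d ∈ n.divisors, (moebius d : ℝ) = if n = 1 then 1 else 0 := by
  have h := congrArg (fun f : ArithmeticFunction ℤ => f n) moebius_mul_coe_zeta
  simp only [coe_mul_zeta_apply, one_apply] at h
  exact_mod_cast h

lemma sum_Icc_dvd_eq (D : ℕ) {d : ℕ} (hd : 0 < d) (f : ℕ → ℝ) :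
    (∑ a ∈ Icc 1 D with d ∣ a, f a) = ∑ k ∈ Icc 1 (D / d), f (d * k) := by
  symm
  refine sum_bij (fun k _ => d * k) ?_ ?_ ?_ ?_
  · intro k hk
    simp only [mem_Icc, mem_filter] at hk ⊢
    refine ⟨⟨Nat.mul_pos hd hk.1, ?_⟩, dvd_mul_right _ _⟩
    rw [mul_comm]
    exact (Nat.le_div_iff_mul_le hd).1 hk.2
  · intro a _ b _ h
    exact Nat.eq_of_mul_eq_mul_left hd h
  · intro a ha
    simp only [mem_Icc, mem_filter] at ha
    obtain ⟨⟨h1, h2⟩, k, rfl⟩ := ha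
    refine ⟨k, ?_, rfl⟩
    simp only [mem_Icc]
    refine ⟨Nat.pos_of_mul_pos_left h1, ?_⟩
    rw [Nat.le_div_iff_mul_le hd, mul_comm]
    exact h2
  · intros; rfl

lemma sum_coprime_mul_eq_sum_moebius (D : ℕ) (f g : ℕ → ℝ) :
    (∑ t ∈ Icc 1 D ×ˢ Icc 1 D with t.1.Coprime t.2, f t.1 * g t.2) =
      ∑ d ∈ Icc 1 D, (moebius d : ℝ) *
        ((∑ k ∈ Icc 1 (D / d), f (d * k)) * ∑ k ∈ Icc 1 (D / d), g (d * k)) := by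
  have h1 : ∀ t ∈ Icc 1 D ×ˢ Icc 1 D,
      (if t.1.Coprime t.2 then f t.1 * g t.2 else 0) =
        ∑ d ∈ Icc 1 D, (moebius d : ℝ) *
          ((if d ∣ t.1 then f t.1 else 0) * (if d ∣ t.2 then g t.2 else 0)) := by
    rintro ⟨a, b⟩ ht
    simp only [mem_product, mem_Icc] at ht
    have hpos : 0 < a.gcd b := Nat.gcd_pos_of_pos_left _ ht.1.1
    have h := sum_divisors_moebius_eq_ite (a.gcd b)
    have hdiv : (a.gcd b).divisors = (Icc 1 D).filter (fun d => d ∣ a ∧ d ∣ b) := by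
      ext d
      simp only [Nat.mem_divisors, mem_filter, mem_Icc, Nat.dvd_gcd_iff]
      constructor
      · rintro ⟨⟨ha, hb⟩, -⟩
        exact ⟨⟨Nat.pos_of_dvd_of_pos ha ht.1.1, (Nat.le_of_dvd ht.1.1 ha).trans ht.1.2⟩, ha, hb⟩
      · rintro ⟨-, h⟩
        exact ⟨h, hpos.ne'⟩
    rw [hdiv, sum_filter] at h
    have h2 : (if a.Coprime b then f a * g b else 0) =
        (if a.gcd b = 1 then (1 : ℝ) else 0) * (f a * g b) := by
      simp [Nat.Coprime]
    rw [h2, ← h, sum_mul]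
    refine sum_congr rfl fun d _ => ?_
    by_cases ha : d ∣ a <;> by_cases hb : d ∣ b <;> simp [ha, hb]
  rw [sum_filter, sum_congr rfl h1, sum_comm]
  refine sum_congr rfl fun d hd => ?_
  rw [← mul_sum, ← sum_Icc_dvd_eq D (mem_Icc.1 hd).1, ← sum_Icc_dvd_eq D (mem_Icc.1 hd).1,
    sum_filter, sum_filter, sum_mul_sum, sum_product]

lemma hasSum_moebius_div_sq :
    HasSum (fun n : ℕ => (moebius n : ℝ) / (n : ℝ) ^ 2) (Real.pi ^ 2 / 6)⁻¹ := by
  have hs : (1 : ℝ) < (2 : ℂ).re := by norm_num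
  have h := (LSeriesSummable_moebius_iff.2 hs).LSeriesHasSum
  have hz := LSeries_zeta_mul_Lseries_moebius hs
  rw [LSeries_zeta_eq_riemannZeta hs, riemannZeta_two] at hz
  rw [eq_inv_of_mul_eq_one_right hz, LSeriesHasSum] at h
  rw [← Complex.hasSum_ofReal]
  convert h using 1
  · ext n
    rcases eq_or_ne n 0 with rfl | hn
    · simp
    · rw [LSeries.term_of_ne_zero hn]
      simp
  · simp

lemma abs_sum_moebius_div_sq_sub_le (D : ℕ) :
    |∑ d ∈ Icc 1 D, (moebius d : ℝ) / (d : ℝ) ^ 2 - (Real.pi ^ 2 / 6)⁻¹| ≤ 2 / (D + 1) := by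
  have hlim := (hasSum_moebius_div_sq.tendsto_sum_nat.const_sub
    (∑ d ∈ Icc 1 D, (moebius d : ℝ) / (d : ℝ) ^ 2)).abs
  refine le_of_tendsto hlim ?_
  filter_upwards [eventually_gt_atTop D] with N hN
  have hsplit : range N = insert 0 (Icc 1 D ∪ Ioo D N) := by
    ext k
    simp only [mem_range, mem_insert, mem_union, mem_Icc, mem_Ioo]
    omega
  have hdisj : Disjoint (Icc 1 D) (Ioo D N) := by
    rw [disjoint_left]
    intro k
    simp only [mem_Icc, mem_Ioo]
    omega
  rw [hsplit, sum_insert (by simp), sum_union hdisj]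
  have h0 : (moebius 0 : ℝ) / ((0 : ℕ) : ℝ) ^ 2 = 0 := by simp
  rw [h0, zero_add, sub_add_cancel_left, abs_neg]
  refine (abs_sum_le_sum_abs _ _).trans ((sum_le_sum fun d _ => ?_).trans
    (sum_Ioo_inv_sq_le D N))
  rw [abs_div, abs_of_nonneg (sq_nonneg (d : ℝ)), div_eq_mul_inv]
  have : |(moebius d : ℝ)| ≤ 1 := by exact_mod_cast abs_moebius_le_one
  exact mul_le_of_le_one_left (by positivity) this

lemma succ_mul_pow_mul_sub_le (r : ℕ) {u v : ℝ} (hv : 0 ≤ v) (huv : v ≤ u) :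
    (r + 1) * (v ^ r * (u - v)) ≤ u ^ (r + 1) - v ^ (r + 1) ∧
      u ^ (r + 1) - v ^ (r + 1) ≤ (r + 1) * (u ^ r * (u - v)) := by
  induction r with
  | zero => simp
  | succ r ih =>
    have hvr : v ^ r ≤ u ^ r := pow_le_pow_left₀ hv huv r
    have hvr' : v ^ (r + 1) ≤ u ^ (r + 1) := pow_le_pow_left₀ hv huv _
    have hs : 0 ≤ u - v := sub_nonneg.2 huv
    have e : u ^ (r + 1 + 1) - v ^ (r + 1 + 1) =
      v * (u ^ (r + 1) - v ^ (r + 1)) + u ^ (r + 1) * (u - v) := by ring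
    have e' : u ^ (r + 1 + 1) - v ^ (r + 1 + 1) =
      u * (u ^ (r + 1) - v ^ (r + 1)) + v ^ (r + 1) * (u - v) := by ring
    push_cast
    constructor
    · rw [e]
      have := mul_le_mul_of_nonneg_left ih.1 hv
      have := mul_le_mul_of_nonneg_right hvr' hs
      have e2 : v * ((r + 1) * (v ^ r * (u - v))) = (r + 1) * (v ^ (r + 1) * (u - v)) := by ring
      linarith
    · rw [e']
      have := mul_le_mul_of_nonneg_left ih.2 (hv.trans huv)
      have := mul_le_mul_of_nonneg_right hvr' hs
      have e2 : u * ((r + 1) * (u ^ r * (u - v))) = (r + 1) * (u ^ (r + 1) * (u - v)) := by ring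
      linarith

/-- The truncated power `x₊ ^ r`, equal to `1` at `x = 0` when `r = 0`. -/
noncomputable def truncPow (r : ℕ) (x : ℝ) : ℝ := if 0 ≤ x then x ^ r else 0

lemma truncPow_nonneg (r : ℕ) (x : ℝ) : 0 ≤ truncPow r x := by
  unfold truncPow
  split_ifs with h
  · positivity
  · rfl

lemma mul_truncPow_sub_le (r : ℕ) {x h : ℝ} (hh : 0 ≤ h) :
    (r + 1) * h * truncPow r (x - h) ≤ truncPow (r + 1) x - truncPow (r + 1) (x - h) ∧
      truncPow (r + 1) x - truncPow (r + 1) (x - h) ≤ (r + 1) * h * truncPow r x := by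
  unfold truncPow
  by_cases h1 : 0 ≤ x - h
  · have h2 : 0 ≤ x := by linarith
    simp only [h1, h2, if_true]
    have := succ_mul_pow_mul_sub_le r h1 (u := x) (by linarith)
    rw [sub_sub_cancel] at this
    constructor <;> linarith
  · by_cases h2 : 0 ≤ x
    · simp only [h1, h2, if_true, if_false, mul_zero, sub_zero]
      refine ⟨by positivity, ?_⟩
      have h3 := (succ_mul_pow_mul_sub_le r le_rfl h2).2
      simp only [sub_zero, ne_eq, Nat.add_eq_zero_iff, one_ne_zero, and_false,
        not_false_eq_true, zero_pow] at h3
      have h4 : x ^ r * x ≤ x ^ r * h := mul_le_mul_of_nonneg_left (by linarith) (by positivity)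
      have : (0 : ℝ) ≤ r + 1 := by positivity
      nlinarith
    · simp [h1, h2]

lemma sum_truncPow_bounds (r n : ℕ) {X h : ℝ} (hX : 0 ≤ X) (hh : 0 < h) (hn : X < h * (n + 1)) :
    0 ≤ X ^ (r + 1) / ((r + 1) * h) - ∑ k ∈ Icc 1 n, truncPow r (X - h * k) ∧
      X ^ (r + 1) / ((r + 1) * h) - ∑ k ∈ Icc 1 n, truncPow r (X - h * k) ≤ X ^ r := by
  have hc : (0 : ℝ) < (r + 1) * h := by positivity
  have key : ∀ k : ℕ,
      (r + 1) * h * truncPow r (X - h * ((k + 1 : ℕ) : ℝ)) ≤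
        truncPow (r + 1) (X - h * k) - truncPow (r + 1) (X - h * ((k + 1 : ℕ) : ℝ)) ∧
      truncPow (r + 1) (X - h * k) - truncPow (r + 1) (X - h * ((k + 1 : ℕ) : ℝ)) ≤
        (r + 1) * h * truncPow r (X - h * k) := by
    intro k
    have := mul_truncPow_sub_le r (x := X - h * k) hh.le
    have e : X - h * k - h = X - h * ((k + 1 : ℕ) : ℝ) := by push_cast; ring
    rwa [e] at this
  have hlast : ¬ 0 ≤ X - h * ((n + 1 : ℕ) : ℝ) := by push_cast; linarith
  have htel := sum_range_sub' (fun k : ℕ => truncPow (r + 1) (X - h * k)) (n + 1)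
  have h0 : truncPow (r + 1) (X - h * ((n + 1 : ℕ) : ℝ)) = 0 := if_neg hlast
  have h0' : truncPow r (X - h * ((n + 1 : ℕ) : ℝ)) = 0 := if_neg hlast
  have hX' : ∀ s, truncPow s (X - h * ((0 : ℕ) : ℝ)) = X ^ s := by simp [truncPow, hX]
  rw [h0, hX', sub_zero] at htel
  have hlow := sum_le_sum fun k (_ : k ∈ range (n + 1)) => (key k).1
  have hupp := sum_le_sum fun k (_ : k ∈ range (n + 1)) => (key k).2
  have hS : ∑ k ∈ Icc 1 n, truncPow r (X - h * k) =
      ∑ k ∈ range n, truncPow r (X - h * ((k + 1 : ℕ) : ℝ)) := by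
    rw [range_eq_Ico, sum_Ico_add' (fun k : ℕ => truncPow r (X - h * k)) 0 n 1]
    rfl
  rw [htel, ← mul_sum] at hlow hupp
  rw [sum_range_succ, h0', add_zero, ← hS] at hlow
  rw [sum_range_succ', hX', ← hS] at hupp
  constructor
  · rw [sub_nonneg, le_div_iff₀ hc]; linarith
  · rw [sub_le_iff_le_add, div_le_iff₀ hc]; linarith

lemma sum_Icc_inv_floor_div_le {w : ℝ} (hw : 0 < w) {M : ℝ} (hM : 1 ≤ M) :
    ∑ d ∈ Icc 1 ⌊M / w⌋₊, (d : ℝ)⁻¹ ≤ (1 + |Real.log w|) * (1 + Real.log M) := by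
  have hlogM : 0 ≤ Real.log M := Real.log_nonneg hM
  rcases Nat.eq_zero_or_pos ⌊M / w⌋₊ with h | h
  · rw [h]
    simp only [Icc_eq_empty_of_lt zero_lt_one, sum_empty]
    positivity
  · have h1 := harmonic_le_one_add_log ⌊M / w⌋₊
    rw [harmonic_eq_sum_Icc] at h1
    push_cast at h1
    have h2 : Real.log (⌊M / w⌋₊ : ℝ) ≤ Real.log (M / w) :=
      Real.log_le_log (by exact_mod_cast h) (Nat.floor_le (by positivity))
    rw [Real.log_div (by positivity) hw.ne'] at h2
    nlinarith [neg_abs_le (Real.log w), mul_nonneg (abs_nonneg (Real.log w)) hlogM]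

lemma abs_sum_moebius_mul_sum_sub_le (r : ℕ) {w : ℝ} (hw : 0 < w) {M X Y : ℝ} (hM : 1 ≤ M)
    (hX : 0 ≤ X) (hXM : X ≤ M) (hY : 0 ≤ Y) (hYM : Y ≤ M) {d : ℕ} (hd : 0 < d) :
    |(∑ k ∈ Icc 1 (⌊M / w⌋₊ / d), truncPow r (X - w * (d * k : ℕ))) *
          (∑ k ∈ Icc 1 (⌊M / w⌋₊ / d), truncPow r (Y - w * (d * k : ℕ))) -
        (X * Y) ^ (r + 1) / ((r + 1) ^ 2 * w ^ 2) / (d : ℝ) ^ 2| ≤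
      2 / w * M ^ (2 * r + 1) * (d : ℝ)⁻¹ := by
  have hd' : (0 : ℝ) < d := by exact_mod_cast hd
  have hM0 : 0 < M := by linarith
  have hn : M < w * d * ((⌊M / w⌋₊ / d : ℕ) + 1) := by
    rw [← Nat.floor_div_natCast]
    have := Nat.lt_floor_add_one (M / w / d)
    rw [div_lt_iff₀ hd', div_lt_iff₀ hw] at this
    linarith
  have bX := sum_truncPow_bounds r _ hX (mul_pos hw hd') (hXM.trans_lt hn)
  have bY := sum_truncPow_bounds r _ hY (mul_pos hw hd') (hYM.trans_lt hn)
  simp only [Nat.cast_mul, ← mul_assoc]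
  set S := ∑ k ∈ Icc 1 (⌊M / w⌋₊ / d), truncPow r (X - w * d * k)
  set S' := ∑ k ∈ Icc 1 (⌊M / w⌋₊ / d), truncPow r (Y - w * d * k)
  have hS : 0 ≤ S := sum_nonneg fun _ _ => truncPow_nonneg _ _
  have hS' : 0 ≤ S' := sum_nonneg fun _ _ => truncPow_nonneg _ _
  have main : ∀ Z, 0 ≤ Z → Z ≤ M → Z ^ (r + 1) / ((r + 1) * (w * d)) ≤ M ^ (r + 1) / (w * d) := by
    intro Z hZ hZM
    refine div_le_div₀ (by positivity) (pow_le_pow_left₀ hZ hZM _) (by positivity) ?_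
    exact le_mul_of_one_le_left (by positivity) (by linarith [Nat.cast_nonneg (α := ℝ) r])
  have mX := main X hX hXM
  have mY := main Y hY hYM
  have eX : X ^ r ≤ M ^ r := pow_le_pow_left₀ hX hXM r
  have eY : Y ^ r ≤ M ^ r := pow_le_pow_left₀ hY hYM r
  have eP : (X * Y) ^ (r + 1) / ((r + 1) ^ 2 * w ^ 2) / (d : ℝ) ^ 2 =
      X ^ (r + 1) / ((r + 1) * (w * d)) * (Y ^ (r + 1) / ((r + 1) * (w * d))) := by
    rw [mul_pow]
    field_simp
  have eB : 2 / w * M ^ (2 * r + 1) * (d : ℝ)⁻¹ =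
      M ^ (r + 1) / (w * d) * M ^ r + M ^ (r + 1) / (w * d) * M ^ r := by
    field_simp
    ring
  rw [eP, eB]
  set p := X ^ (r + 1) / ((r + 1) * (w * d))
  set q := Y ^ (r + 1) / ((r + 1) * (w * d))
  set m := M ^ (r + 1) / (w * d)
  have hm : 0 ≤ m := by positivity
  have h1 : p * (q - S') ≤ m * M ^ r :=
    mul_le_mul mX (bY.2.trans eY) bY.1 hm
  have h2 : S' * (p - S) ≤ m * M ^ r :=
    mul_le_mul (by linarith) (bX.2.trans eX) bX.1 hm
  have h3 : 0 ≤ p * (q - S') := mul_nonneg (by linarith) bY.1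
  have h4 : 0 ≤ S' * (p - S) := mul_nonneg hS' bX.1
  have e : S * S' - p * q = -(p * (q - S') + S' * (p - S)) := by ring
  rw [e, abs_neg, abs_of_nonneg (by linarith)]
  linarith

/-- The pairs of coprime positive integers with both entries at most `D`. -/
def coprimePairs (D : ℕ) : Finset (ℕ × ℕ) :=
  {t ∈ Icc 1 D ×ˢ Icc 1 D | t.1.Coprime t.2}

lemma exists_sum_coprimePairs_truncPow_bound (r : ℕ) {w : ℝ} (hw : 0 < w) :
    ∃ K : ℝ, 0 ≤ K ∧ ∀ M X Y : ℝ, 1 ≤ M → 0 ≤ X → X ≤ M → 0 ≤ Y → Y ≤ M →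
      |∑ t ∈ coprimePairs ⌊M / w⌋₊, truncPow r (X - w * t.1) * truncPow r (Y - w * t.2) -
          (X * Y) ^ (r + 1) / ((r + 1) ^ 2 * w ^ 2) * (Real.pi ^ 2 / 6)⁻¹| ≤
        K * (M ^ (2 * r + 1) * (1 + Real.log M)) := by
  refine ⟨2 / w * (1 + |Real.log w|) + 2 / w, by positivity, ?_⟩
  intro M X Y hM hX hXM hY hYM
  have hM0 : 0 < M := by linarith
  have hlogM : 0 ≤ Real.log M := Real.log_nonneg hM
  set D := ⌊M / w⌋₊ with hD
  set P := (X * Y) ^ (r + 1) / ((r + 1) ^ 2 * w ^ 2) with hP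
  have hPM : P ≤ M ^ (2 * r + 2) / w ^ 2 := by
    have e : M ^ (2 * r + 2) = (M * M) ^ (r + 1) := by ring
    rw [e]
    refine div_le_div₀ (by positivity)
      (pow_le_pow_left₀ (by positivity) (mul_le_mul hXM hYM hY hM0.le) _) (by positivity) ?_
    refine le_mul_of_one_le_left (by positivity) (one_le_pow₀ ?_)
    linarith [Nat.cast_nonneg (α := ℝ) r]
  have hP0 : 0 ≤ P := by positivity
  unfold coprimePairs
  rw [sum_coprime_mul_eq_sum_moebius D (fun a => truncPow r (X - w * a))
    (fun b => truncPow r (Y - w * b))]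
  set c := (Real.pi ^ 2 / 6)⁻¹
  have hdiff : |∑ d ∈ Icc 1 D, (moebius d : ℝ) *
        ((∑ k ∈ Icc 1 (D / d), truncPow r (X - w * (d * k : ℕ))) *
          ∑ k ∈ Icc 1 (D / d), truncPow r (Y - w * (d * k : ℕ))) -
      P * ∑ d ∈ Icc 1 D, (moebius d : ℝ) / (d : ℝ) ^ 2| ≤
      2 / w * M ^ (2 * r + 1) * ((1 + |Real.log w|) * (1 + Real.log M)) := by
    rw [mul_sum, ← sum_sub_distrib]
    refine (abs_sum_le_sum_abs _ _).trans
      (le_trans (sum_le_sum fun d hd => ?_) (b := ∑ d ∈ Icc 1 D,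
        2 / w * M ^ (2 * r + 1) * (d : ℝ)⁻¹) ?_)
    · have hμ : |(moebius d : ℝ)| ≤ 1 := by exact_mod_cast abs_moebius_le_one
      have h := abs_sum_moebius_mul_sum_sub_le r hw hM hX hXM hY hYM (mem_Icc.1 hd).1
      rw [← hD, ← hP] at h
      rw [show P * ((moebius d : ℝ) / (d : ℝ) ^ 2) = moebius d * (P / (d : ℝ) ^ 2) by ring,
        ← mul_sub, abs_mul]
      exact (mul_le_of_le_one_left (abs_nonneg _) hμ).trans h
    · rw [← mul_sum]
      exact mul_le_mul_of_nonneg_left (sum_Icc_inv_floor_div_le hw hM) (by positivity)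
  have htail : |P * ∑ d ∈ Icc 1 D, (moebius d : ℝ) / (d : ℝ) ^ 2 - P * c| ≤
      2 / w * M ^ (2 * r + 1) := by
    rw [← mul_sub, abs_mul, abs_of_nonneg hP0]
    have h1 := abs_sum_moebius_div_sq_sub_le D
    have h2 : (2 : ℝ) / (D + 1) ≤ 2 * w / M := by
      have := (Nat.lt_floor_add_one (M / w)).le
      rw [← hD, div_le_iff₀ hw] at this
      rw [div_le_div_iff₀ (by positivity) hM0]
      linarith
    refine (mul_le_mul hPM (h1.trans h2) (abs_nonneg _) (by positivity)).trans_eq ?_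
    field_simp
    ring
  refine (abs_sub_le _ _ _).trans ((add_le_add hdiff htail).trans ?_)
  have h5 : 2 / w * M ^ (2 * r + 1) ≤ 2 / w * (M ^ (2 * r + 1) * (1 + Real.log M)) :=
    mul_le_mul_of_nonneg_left (le_mul_of_one_le_right (by positivity) (by linarith))
      (by positivity)
  linarith

/-- Vectors of coprime pairs of positive integers whose weighted coordinate sums are at most
`X` and `Y` respectively. -/
def coprimeVectors {r : ℕ} (w : Fin r → ℝ) (X Y : ℝ) : Set (Fin r → ℕ × ℕ) :=
  {c | (∀ i, 0 < (c i).1 ∧ 0 < (c i).2 ∧ (c i).1.Coprime (c i).2) ∧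
    ∑ i, w i * (c i).1 ≤ X ∧ ∑ i, w i * (c i).2 ≤ Y}

lemma coprimeVectors_eq_empty {r : ℕ} {w : Fin r → ℝ} (hw : ∀ i, 0 < w i) {X Y : ℝ}
    (h : X < 0 ∨ Y < 0) : coprimeVectors w X Y = ∅ := by
  refine Set.eq_empty_of_forall_notMem fun c ⟨_, h1, h2⟩ => ?_
  have h3 : 0 ≤ ∑ i, w i * (c i).1 :=
    sum_nonneg fun i _ => mul_nonneg (hw i).le (Nat.cast_nonneg _)
  have h4 : 0 ≤ ∑ i, w i * (c i).2 :=
    sum_nonneg fun i _ => mul_nonneg (hw i).le (Nat.cast_nonneg _)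
  rcases h with h | h <;> linarith

lemma coprimeVectors_succ {r : ℕ} {w : Fin (r + 1) → ℝ} (hw : ∀ i, 0 < w i) {M X Y : ℝ}
    (hXM : X ≤ M) (hYM : Y ≤ M) :
    coprimeVectors w X Y = ⋃ t ∈ coprimePairs ⌊M / w 0⌋₊,
      Fin.cons (α := fun _ => ℕ × ℕ) t ''
        coprimeVectors (Fin.tail w) (X - w 0 * t.1) (Y - w 0 * t.2) := by
  have le_floor : ∀ (v : Fin (r + 1) → ℕ) (Z : ℝ), Z ≤ M → ∑ i, w i * v i ≤ Z →
      v 0 ≤ ⌊M / w 0⌋₊ := by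
    intro v Z hZM hZ
    refine Nat.le_floor ?_
    rw [le_div_iff₀ (hw 0), mul_comm]
    exact ((single_le_sum (f := fun i => w i * (v i : ℝ))
      (fun i _ => mul_nonneg (hw i).le (Nat.cast_nonneg _)) (mem_univ 0)).trans hZ).trans hZM
  ext c
  simp only [Set.mem_iUnion, Set.mem_image, exists_prop, coprimePairs, mem_filter, mem_product,
    mem_Icc]
  constructor
  · rintro ⟨hc, h1, h2⟩
    refine ⟨c 0, ⟨⟨⟨(hc 0).1, le_floor (fun i => (c i).1) X hXM h1⟩, (hc 0).2.1,
      le_floor (fun i => (c i).2) Y hYM h2⟩, (hc 0).2.2⟩,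
      Fin.tail c, ⟨fun i => hc i.succ, ?_, ?_⟩, Fin.cons_self_tail c⟩
    · rw [Fin.sum_univ_succ] at h1
      simp only [Fin.tail]
      linarith
    · rw [Fin.sum_univ_succ] at h2
      simp only [Fin.tail]
      linarith
  · rintro ⟨t, ⟨⟨⟨ht1, -⟩, ht2, -⟩, ht⟩, c, ⟨hc, h1, h2⟩, rfl⟩
    simp only [Fin.tail] at h1 h2
    refine ⟨Fin.cases ⟨ht1, ht2, ht⟩ hc, ?_, ?_⟩
    · rw [Fin.sum_univ_succ]
      simp only [Fin.cons_zero, Fin.cons_succ]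
      linarith
    · rw [Fin.sum_univ_succ]
      simp only [Fin.cons_zero, Fin.cons_succ]
      linarith

lemma finite_coprimeVectors {r : ℕ} {w : Fin r → ℝ} (hw : ∀ i, 0 < w i) (X Y : ℝ) :
    (coprimeVectors w X Y).Finite := by
  induction r generalizing X Y with
  | zero => exact Set.toFinite _
  | succ r ih =>
    rw [coprimeVectors_succ hw (le_max_left X Y) (le_max_right X Y)]
    exact Set.Finite.biUnion (finite_toSet _) fun t _ => (ih (fun i => hw i.succ) _ _).image _

lemma ncard_coprimeVectors_succ {r : ℕ} {w : Fin (r + 1) → ℝ} (hw : ∀ i, 0 < w i) {M X Y : ℝ}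
    (hXM : X ≤ M) (hYM : Y ≤ M) :
    (coprimeVectors w X Y).ncard = ∑ t ∈ coprimePairs ⌊M / w 0⌋₊,
      (coprimeVectors (Fin.tail w) (X - w 0 * t.1) (Y - w 0 * t.2)).ncard := by
  classical
  have hfin := fun X Y => finite_coprimeVectors (w := Fin.tail w) (fun i => hw i.succ) X Y
  have h : coprimeVectors w X Y = ((coprimePairs ⌊M / w 0⌋₊).biUnion fun t =>
      (hfin (X - w 0 * t.1) (Y - w 0 * t.2)).toFinset.image
        (Fin.cons (α := fun _ => ℕ × ℕ) t) :
      Finset (Fin (r + 1) → ℕ × ℕ)) := by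
    rw [coprimeVectors_succ hw hXM hYM]
    simp
  rw [h, Set.ncard_coe_finset, card_biUnion]
  · refine sum_congr rfl fun t _ => ?_
    rw [card_image_of_injective _ (Fin.cons_right_injective (α := fun _ => ℕ × ℕ) t),
      Set.ncard_eq_toFinset_card _ (hfin _ _)]
  · intro t _ t' _ htt'
    rw [Function.onFun, disjoint_left]
    intro c hc hc'
    simp only [mem_image] at hc hc'
    obtain ⟨_, -, rfl⟩ := hc
    obtain ⟨_, -, h⟩ := hc'
    exact htt' (by simpa using (congrFun h 0).symm)

lemma card_coprimePairs_le {w : ℝ} (hw : 0 < w) {M : ℝ} (hM : 0 ≤ M) :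
    ((coprimePairs ⌊M / w⌋₊).card : ℝ) ≤ (M / w) ^ 2 := by
  have h1 : (coprimePairs ⌊M / w⌋₊).card ≤ ⌊M / w⌋₊ * ⌊M / w⌋₊ := by
    refine (card_filter_le _ _).trans_eq ?_
    simp
  have h2 : (⌊M / w⌋₊ : ℝ) ≤ M / w := Nat.floor_le (by positivity)
  calc ((coprimePairs ⌊M / w⌋₊).card : ℝ) ≤ (⌊M / w⌋₊ : ℝ) * ⌊M / w⌋₊ := by exact_mod_cast h1
    _ ≤ (M / w) ^ 2 := by
      rw [sq]
      exact mul_le_mul h2 h2 (Nat.cast_nonneg _) (by positivity)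

/-- The density of `coprimeVectors w X Y` relative to `X ^ r * Y ^ r`. -/
noncomputable def coprimeVectorsDensity {r : ℕ} (w : Fin r → ℝ) : ℝ :=
  1 / ((r.factorial : ℝ) ^ 2 * (Real.pi ^ 2 / 6) ^ r) * ∏ i, 1 / w i ^ 2

lemma coprimeVectorsDensity_succ {r : ℕ} (w : Fin (r + 1) → ℝ) :
    coprimeVectorsDensity w = coprimeVectorsDensity (Fin.tail w) *
      (1 / ((r + 1) ^ 2 * w 0 ^ 2) * (Real.pi ^ 2 / 6)⁻¹) := by
  unfold coprimeVectorsDensity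
  rw [Fin.prod_univ_succ, Nat.factorial_succ]
  simp only [Fin.tail, one_div, mul_inv, mul_pow, pow_succ, Nat.cast_mul, Nat.cast_add,
    Nat.cast_one]
  ring

lemma coprimeVectorsDensity_nonneg {r : ℕ} (w : Fin r → ℝ) : 0 ≤ coprimeVectorsDensity w :=
  mul_nonneg (by positivity) (prod_nonneg fun i _ => by positivity)

/-- The error term is multiplied by `M` so that the bound makes sense for `r = 0`. -/
lemma exists_ncard_coprimeVectors_bound {r : ℕ} {w : Fin r → ℝ} (hw : ∀ i, 0 < w i) :
    ∃ K : ℝ, 0 ≤ K ∧ ∀ M X Y : ℝ, 1 ≤ M → X ≤ M → Y ≤ M →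
      |(coprimeVectors w X Y).ncard -
          coprimeVectorsDensity w * (truncPow r X * truncPow r Y)| * M ≤
        K * (M ^ (2 * r) * (1 + Real.log M)) := by
  induction r with
  | zero =>
    refine ⟨0, le_rfl, fun M X Y hM hXM hYM => ?_⟩
    by_cases h : X < 0 ∨ Y < 0
    · rw [coprimeVectors_eq_empty hw h]
      rcases h with h | h <;> simp [truncPow, h.not_ge]
    · push Not at h
      have : coprimeVectors w X Y = Set.univ := by
        ext c
        simp [coprimeVectors, h]
      rw [this]
      simp [truncPow, h, coprimeVectorsDensity, Set.ncard_univ]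
  | succ r ih =>
    obtain ⟨K, hK, ih⟩ := ih (w := Fin.tail w) fun i => hw i.succ
    obtain ⟨K', hK', hsum⟩ := exists_sum_coprimePairs_truncPow_bound r (hw 0)
    have hw0 := hw 0
    have hden := coprimeVectorsDensity_nonneg (Fin.tail w)
    refine ⟨K / w 0 ^ 2 + coprimeVectorsDensity (Fin.tail w) * K', by positivity,
      fun M X Y hM hXM hYM => ?_⟩
    have hM0 : 0 < M := by linarith
    have hlogM : 0 ≤ Real.log M := Real.log_nonneg hM
    by_cases h : X < 0 ∨ Y < 0
    · rw [coprimeVectors_eq_empty hw h]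
      have : truncPow (r + 1) X * truncPow (r + 1) Y = 0 := by
        rcases h with h | h <;> simp [truncPow, h.not_ge]
      rw [this]
      simp only [Set.ncard_empty, Nat.cast_zero, mul_zero, sub_zero, abs_zero, zero_mul]
      positivity
    push Not at h
    have hT : truncPow (r + 1) X * truncPow (r + 1) Y = (X * Y) ^ (r + 1) := by
      simp [truncPow, h, mul_pow]
    rw [hT, ncard_coprimeVectors_succ hw hXM hYM, coprimeVectorsDensity_succ]
    set c := coprimeVectorsDensity (Fin.tail w)
    set T := coprimePairs ⌊M / w 0⌋₊
    have h1 : |∑ t ∈ T, ((coprimeVectors (Fin.tail w) (X - w 0 * t.1) (Y - w 0 * t.2)).ncard : ℝ) -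
        c * ∑ t ∈ T, truncPow r (X - w 0 * t.1) * truncPow r (Y - w 0 * t.2)| * M ≤
        K / w 0 ^ 2 * (M ^ (2 * (r + 1)) * (1 + Real.log M)) := by
      rw [mul_sum, ← sum_sub_distrib]
      calc _ ≤ (∑ t ∈ T, |((coprimeVectors (Fin.tail w) (X - w 0 * t.1)
              (Y - w 0 * t.2)).ncard : ℝ) -
              c * (truncPow r (X - w 0 * t.1) * truncPow r (Y - w 0 * t.2))|) * M :=
            mul_le_mul_of_nonneg_right (abs_sum_le_sum_abs _ _) hM0.le
        _ ≤ ∑ t ∈ T, K * (M ^ (2 * r) * (1 + Real.log M)) := by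
            rw [sum_mul]
            refine sum_le_sum fun t _ => ih M _ _ hM ?_ ?_
            · exact (sub_le_self _ (by positivity)).trans hXM
            · exact (sub_le_self _ (by positivity)).trans hYM
        _ ≤ (M / w 0) ^ 2 * (K * (M ^ (2 * r) * (1 + Real.log M))) := by
            rw [sum_const, nsmul_eq_mul]
            exact mul_le_mul_of_nonneg_right (card_coprimePairs_le hw0 hM0.le) (by positivity)
        _ = K / w 0 ^ 2 * (M ^ (2 * (r + 1)) * (1 + Real.log M)) := by
            field_simp
            ring
    have h2 := mul_le_mul_of_nonneg_right
      (mul_le_mul_of_nonneg_left (hsum M X Y hM h.1 hXM h.2 hYM) hden) hM0.le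
    rw [← abs_of_nonneg hden, ← abs_mul, abs_of_nonneg hden, mul_sub] at h2
    have h3 := mul_le_mul_of_nonneg_right (abs_sub_le
      (∑ t ∈ T, ((coprimeVectors (Fin.tail w) (X - w 0 * t.1) (Y - w 0 * t.2)).ncard : ℝ))
      (c * ∑ t ∈ T, truncPow r (X - w 0 * t.1) * truncPow r (Y - w 0 * t.2))
      (c * ((X * Y) ^ (r + 1) / ((r + 1) ^ 2 * w 0 ^ 2) * (Real.pi ^ 2 / 6)⁻¹))) hM0.le
    have e1 : c * (1 / ((r + 1) ^ 2 * w 0 ^ 2) * (Real.pi ^ 2 / 6)⁻¹) * (X * Y) ^ (r + 1) =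
        c * ((X * Y) ^ (r + 1) / ((r + 1) ^ 2 * w 0 ^ 2) * (Real.pi ^ 2 / 6)⁻¹) := by ring
    have e2 : c * (K' * (M ^ (2 * r + 1) * (1 + Real.log M))) * M =
        c * K' * (M ^ (2 * (r + 1)) * (1 + Real.log M)) := by ring
    push_cast
    rw [e1]
    rw [e2] at h2
    linarith

section PrimePowers

variable {r : ℕ} {p : Fin r → ℕ}

lemma factorization_prod_pow_apply (hp : ∀ i, (p i).Prime) (hinj : Function.Injective p)
    (a : Fin r → ℕ) (i : Fin r) : (∏ j, p j ^ a j).factorization (p i) = a i := by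
  rw [Nat.factorization_prod fun j _ => pow_ne_zero _ (hp j).ne_zero, Finsupp.finsetSum_apply,
    sum_eq_single i]
  · simp [(hp i).factorization_pow]
  · intro j _ hji
    simp [(hp j).factorization_pow, hinj.ne hji]
  · simp

lemma primeFactors_prod_pow (hp : ∀ i, (p i).Prime) {a : Fin r → ℕ} (ha : ∀ i, 0 < a i) :
    (∏ j, p j ^ a j).primeFactors = image p univ := by
  have hne : ∏ j, p j ^ a j ≠ 0 := prod_ne_zero_iff.2 fun j _ => pow_ne_zero _ (hp j).ne_zero
  ext q
  simp only [Nat.mem_primeFactors, mem_image, mem_univ, true_and]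
  constructor
  · rintro ⟨hq, hdvd, -⟩
    obtain ⟨j, -, hj⟩ := (hq.prime.dvd_finsetProd_iff _).1 hdvd
    exact ⟨j, ((Nat.prime_dvd_prime_iff_eq hq (hp j)).1 (hq.dvd_of_dvd_pow hj)).symm⟩
  · rintro ⟨j, rfl⟩
    exact ⟨hp j, (dvd_pow_self _ (ha j).ne').trans
      (dvd_prod_of_mem (fun j => p j ^ a j) (mem_univ j)), hne⟩

lemma prod_pow_factorization_eq (hinj : Function.Injective p) {n : ℕ} (hn : n ≠ 0)
    (h : n.primeFactors = image p univ) : ∏ j, p j ^ n.factorization (p j) = n := by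
  conv_rhs => rw [← Nat.prod_factorization_pow_eq_self hn]
  rw [Finsupp.prod, Nat.support_factorization, h, prod_image fun _ _ _ _ e => hinj e]

lemma prod_pow_le_iff (hp : ∀ i, (p i).Prime) (a : Fin r → ℕ) {x : ℝ} (hx : 0 < x) :
    ((∏ j, p j ^ a j : ℕ) : ℝ) ≤ x ↔ ∑ j, Real.log (p j) * a j ≤ Real.log x := by
  have hpos : ∀ j, (0 : ℝ) < p j := fun j => by exact_mod_cast (hp j).pos
  push_cast
  rw [← Real.log_le_log_iff (prod_pos fun j _ => pow_pos (hpos j) _) hx,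
    Real.log_prod fun j _ => (pow_pos (hpos j) _).ne']
  simp only [Real.log_pow, mul_comm]

lemma ncard_expCoprime_pairs (hr : 1 ≤ r) (hp : ∀ i, (p i).Prime)
    (hinj : Function.Injective p) {x : ℝ} (hx : 0 < x) :
    Set.ncard {nm : ℕ × ℕ | (nm.1 : ℝ) ≤ x ∧ (nm.2 : ℝ) ≤ x ∧ ExpCoprime nm.1 nm.2 ∧
        nm.1.primeFactors = image p univ ∧ nm.2.primeFactors = image p univ} =
      (coprimeVectors (fun i => Real.log (p i)) (Real.log x) (Real.log x)).ncard := by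
  symm
  refine Set.BijOn.ncard_eq
    (f := fun c => (∏ j, p j ^ (c j).1, ∏ j, p j ^ (c j).2)) ⟨?_, ?_, ?_⟩
  · rintro c ⟨hc, h1, h2⟩
    have hf1 := primeFactors_prod_pow hp fun i => (hc i).1
    have hf2 := primeFactors_prod_pow hp fun i => (hc i).2.1
    have one_lt : ∀ n : ℕ, n.primeFactors = image p univ → 1 < n := by
      intro n hn
      rw [← Nat.nonempty_primeFactors, hn]
      exact ⟨p ⟨0, hr⟩, mem_image_of_mem _ (mem_univ _)⟩
    refine ⟨(prod_pow_le_iff hp _ hx).2 h1, (prod_pow_le_iff hp _ hx).2 h2,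
      Or.inr ⟨one_lt _ hf1, one_lt _ hf2, hf1.trans hf2.symm, ?_⟩, hf1, hf2⟩
    intro q hq
    simp only [hf1, mem_image, mem_univ, true_and] at hq
    obtain ⟨i, rfl⟩ := hq
    simp only [factorization_prod_pow_apply hp hinj]
    exact (hc i).2.2
  · intro c _ c' _ h
    simp only [Prod.mk.injEq] at h
    ext i
    · rw [← factorization_prod_pow_apply hp hinj (fun j => (c j).1), h.1,
        factorization_prod_pow_apply hp hinj]
    · rw [← factorization_prod_pow_apply hp hinj (fun j => (c j).2), h.2,
        factorization_prod_pow_apply hp hinj]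
  · rintro ⟨n, m⟩ ⟨hn, hm, hnm, hfn, hfm⟩
    simp only at hn hm hnm hfn hfm
    have hmem : ∀ i, p i ∈ image p univ := fun i => mem_image_of_mem _ (mem_univ i)
    have hne : ∀ k : ℕ, k.primeFactors = image p univ → k ≠ 0 ∧ k ≠ 1 := by
      intro k hk
      have := hk ▸ hmem ⟨0, hr⟩
      constructor <;> rintro rfl <;> simp at this
    have hn' := prod_pow_factorization_eq hinj (hne n hfn).1 hfn
    have hm' := prod_pow_factorization_eq hinj (hne m hfm).1 hfm
    refine ⟨fun i => (n.factorization (p i), m.factorization (p i)), ⟨fun i => ⟨?_, ?_, ?_⟩,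
      ?_, ?_⟩, by simp only [hn', hm']⟩
    · exact Nat.pos_of_ne_zero (Finsupp.mem_support_iff.1 (by
        rw [Nat.support_factorization, hfn]; exact hmem i))
    · exact Nat.pos_of_ne_zero (Finsupp.mem_support_iff.1 (by
        rw [Nat.support_factorization, hfm]; exact hmem i))
    · rcases hnm with hnm | hnm
      · exact absurd hnm.1 (hne n hfn).2
      · exact hnm.2.2.2 _ (hfn ▸ hmem i)
    · rw [← prod_pow_le_iff hp _ hx, hn']
      exact hn
    · rw [← prod_pow_le_iff hp _ hx, hm']
      exact hm

end PrimePowers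

end

/-- **Theorem 2.** For fixed `r ≥ 1` and fixed distinct primes `p 1, ..., p r`, the
number `P^{(e)}(p_1,...,p_r;x)` of ordered pairs `⟨n,m⟩` of exponentially coprime
integers with squarefree kernels `κ(n) = κ(m) = p_1 ⋯ p_r` and `n, m ≤ x` satisfies
`P^{(e)}(p_1,...,p_r;x) = (1/((r!)² ζ(2)^r)) (∏ i, 1/(log p_i)²) (log x)^{2r}
+ O((log x)^{2r-1} log log x)` as `x → ∞`, where `ζ(2) = π²/6`. -/
theorem expCoprime_pairs_asymptotic
    (r : ℕ) (hr : 1 ≤ r) (p : Fin r → ℕ)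
    (hp : ∀ i, (p i).Prime) (hinj : Function.Injective p) :
    (fun x : ℝ =>
        (Set.ncard {nm : ℕ × ℕ | (nm.1 : ℝ) ≤ x ∧ (nm.2 : ℝ) ≤ x ∧
            ExpCoprime nm.1 nm.2 ∧
            nm.1.primeFactors = Finset.image p Finset.univ ∧
            nm.2.primeFactors = Finset.image p Finset.univ} : ℝ) -
          (1 / ((r.factorial : ℝ) ^ 2 * (Real.pi ^ 2 / 6) ^ r)) *
            (∏ i, 1 / Real.log (p i) ^ 2) * Real.log x ^ (2 * r))
      =O[atTop]
        (fun x : ℝ => Real.log x ^ (2 * r - 1) * Real.log (Real.log x)) := by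
  have hlog : ∀ i, 0 < Real.log (p i) := fun i =>
    Real.log_pos (by exact_mod_cast (hp i).one_lt)
  obtain ⟨K, hK, hbound⟩ := exists_ncard_coprimeVectors_bound hlog
  refine Asymptotics.IsBigO.of_bound (2 * K) ?_
  filter_upwards [eventually_ge_atTop (Real.exp (Real.exp 1))] with x hx
  have hx0 : 0 < x := (Real.exp_pos _).trans_le hx
  have hL : Real.exp 1 ≤ Real.log x := (Real.le_log_iff_exp_le hx0).2 hx
  have hL1 : 1 ≤ Real.log x := (Real.one_le_exp zero_le_one).trans hL
  have hL0 : 0 < Real.log x := by linarith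
  have hLL : 1 ≤ Real.log (Real.log x) := (Real.le_log_iff_exp_le hL0).2 hL
  have h := hbound (Real.log x) (Real.log x) (Real.log x) hL1 le_rfl le_rfl
  have hpow : truncPow r (Real.log x) * truncPow r (Real.log x) = Real.log x ^ (2 * r) := by
    rw [truncPow, if_pos hL0.le]
    ring
  rw [hpow, coprimeVectorsDensity] at h
  rw [ncard_expCoprime_pairs hr hp hinj hx0, Real.norm_eq_abs, Real.norm_eq_abs,
    abs_of_nonneg (a := Real.log x ^ (2 * r - 1) * Real.log (Real.log x)) (by positivity)]
  refine le_of_mul_le_mul_right (h.trans ?_) hL0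
  have e : Real.log x ^ (2 * r) = Real.log x ^ (2 * r - 1) * Real.log x := by
    rw [← pow_succ]
    congr 1
    omega
  calc K * (Real.log x ^ (2 * r) * (1 + Real.log (Real.log x)))
      ≤ K * (Real.log x ^ (2 * r) * (2 * Real.log (Real.log x))) := by
        gcongr
        linarith
    _ = 2 * K * (Real.log x ^ (2 * r - 1) * Real.log (Real.log x)) * Real.log x := by
        rw [e]
        ring
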